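/- arXiv:2006.01176 — 2 statements merged into one kernel-verified Lean document; each statement's English description precedes it below -/
import Mathlib

section
/- Let R be a commutative ring and (A, D_G) a 1-tilting cotorsion pair with associated Gabriel topology G. If A is a covering class, then the ring of quotients R_G is a perfect ring. -/
universe u

/-- A Gabriel topology on a commutative ring `R`: a filter of ideals of `R`
satisfying the Gabriel axiom T4. -/
structure GabrielTopology (R : Type u) [CommRing R] : Type u where
  sets : Set (Ideal R)
  top_mem : (⊤ : Ideal R) ∈ sets
  mem_of_le : ∀ {I J : Ideal R}, I ∈ sets → I ≤ J → J ∈ sets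
  inf_mem : ∀ {I J : Ideal R}, I ∈ sets → J ∈ sets → I ⊓ J ∈ sets
  gabriel : ∀ I J : Ideal R, J ∈ sets →
    (∀ r ∈ J, Submodule.colon I (Ideal.span {r}) ∈ sets) → I ∈ sets

namespace GabrielTopology

variable {R : Type u} [CommRing R] (G : GabrielTopology R)

/-- A module `M` is `G`-torsion if the annihilator of every element belongs to `G`. -/
def IsTorsion (M : Type u) [AddCommGroup M] [Module R M] : Prop :=
  ∀ x : M, Ideal.torsionOf R M x ∈ G.sets

/-- A module `M` is `G`-torsion-free if no nonzero element is annihilated by an ideal of `G`. -/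
def IsTorsionFree (M : Type u) [AddCommGroup M] [Module R M] : Prop :=
  ∀ x : M, Ideal.torsionOf R M x ∈ G.sets → x = 0

/-- A module `M` is `G`-divisible if `JM = M` for every `J ∈ G`. -/
def IsDivisible (M : Type u) [AddCommGroup M] [Module R M] : Prop :=
  ∀ J ∈ G.sets, J • (⊤ : Submodule R M) = ⊤

/-- `G` is faithful if `R` is `G`-torsion-free. -/
def Faithful : Prop := ∀ r : R, Ideal.torsionOf R R r ∈ G.sets → r = 0

/-- `G` is finitely generated if it has a basis of finitely generated ideals. -/
def FinitelyGenerated : Prop := ∀ J ∈ G.sets, ∃ J' ∈ G.sets, J' ≤ J ∧ J'.FG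

end GabrielTopology

/-- `Ext¹_R(M, N) = 0`, expressed by the standard characterisation:
every short exact sequence `0 → N → E → M → 0` splits. -/
def Ext1Vanish (R : Type u) [CommRing R] (M N : Type u) [AddCommGroup M] [Module R M]
    [AddCommGroup N] [Module R N] : Prop :=
  ∀ (E : Type u) [AddCommGroup E] [Module R E] (i : N →ₗ[R] E) (p : E →ₗ[R] M),
    Function.Injective i → Function.Surjective p → LinearMap.range i = LinearMap.ker p →
      ∃ s : M →ₗ[R] E, p ∘ₗ s = LinearMap.id

/-- `M` has projective dimension at most 1: the kernel of a free cover is projective. -/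
def ProjDimLE1 (R : Type u) [CommRing R] (M : Type u) [AddCommGroup M] [Module R M] : Prop :=
  ∃ (ι : Type u) (p : (ι →₀ R) →ₗ[R] M),
    Function.Surjective p ∧ Module.Projective R ↥(LinearMap.ker p)

/-- `M ∈ Add(T)`: `M` is a direct summand of a direct sum of copies of `T`. -/
def InAdd (R : Type u) [CommRing R] (T M : Type u) [AddCommGroup T] [Module R T]
    [AddCommGroup M] [Module R M] : Prop :=
  ∃ (ι : Type u) (s : M →ₗ[R] (ι →₀ T)) (r : (ι →₀ T) →ₗ[R] M), r ∘ₗ s = LinearMap.id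

/-- `T` is a 1-tilting module: (T1) `p.dim T ≤ 1`, (T2) `Ext¹(T, T^(κ)) = 0` for all κ,
(T3) there is an exact sequence `0 → R → T₀ → T₁ → 0` with `T₀, T₁ ∈ Add(T)`. -/
def Is1Tilting (R : Type u) [CommRing R] (T : Type u) [AddCommGroup T] [Module R T] : Prop :=
  ProjDimLE1 R T ∧
  (∀ ι : Type u, Ext1Vanish R T (ι →₀ T)) ∧
  ∃ (T0 T1 : ModuleCat.{u} R) (i : R →ₗ[R] ↥T0) (p : ↥T0 →ₗ[R] ↥T1),
    InAdd R T ↥T0 ∧ InAdd R T ↥T1 ∧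
    Function.Injective i ∧ Function.Surjective p ∧ LinearMap.range i = LinearMap.ker p

namespace GabrielTopology

variable {R : Type u} [CommRing R] (G : GabrielTopology R)

/-- `(𝒜, 𝒟_G)` is a 1-tilting cotorsion pair with associated Gabriel topology `G`:
`G` is a faithful finitely generated Gabriel topology and the class of `G`-divisible
modules is the tilting class of a 1-tilting module. -/
def IsTiltingTopology : Prop :=
  G.Faithful ∧ G.FinitelyGenerated ∧
  ∃ T : ModuleCat.{u} R, Is1Tilting R ↥T ∧
    ∀ (M : Type u) [AddCommGroup M] [Module R M], (Ext1Vanish R ↥T M ↔ G.IsDivisible M)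

/-- Membership in the left-hand class `𝒜 = ᗮ(𝒟_G)` of the 1-tilting cotorsion pair. -/
def MemA (M : Type u) [AddCommGroup M] [Module R M] : Prop :=
  ∀ (D : Type u) [AddCommGroup D] [Module R D], G.IsDivisible D → Ext1Vanish R M D

/-- The class `𝒜` is covering: every module has an `𝒜`-cover. -/
def IsACovering : Prop :=
  ∀ (M : Type u) [AddCommGroup M] [Module R M],
    ∃ (C : ModuleCat.{u} R) (φ : ↥C →ₗ[R] M),
      G.MemA ↥C ∧
      (∀ (C' : Type u) [AddCommGroup C'] [Module R C'], G.MemA C' →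
        ∀ f : C' →ₗ[R] M, ∃ g : C' →ₗ[R] ↥C, φ ∘ₗ g = f) ∧
      (∀ e : ↥C →ₗ[R] ↥C, φ ∘ₗ e = φ → Function.Bijective e)

/-- The class `𝒜` is closed under direct limits. -/
def AClosedUnderDirectLimits : Prop :=
  ∀ (ι : Type u) [Preorder ι] [IsDirected ι (· ≤ ·)] [Nonempty ι] [DecidableEq ι]
    (M : ι → Type u) [∀ i, AddCommGroup (M i)] [∀ i, Module R (M i)]
    (f : ∀ i j, i ≤ j → M i →ₗ[R] M j) [DirectedSystem M fun i j h => f i j h],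
    (∀ i, G.MemA (M i)) → G.MemA (Module.DirectLimit M f)

/-- `Q`, via `algebraMap R Q`, is the ring of quotients `R_G` of `R` with respect to `G`:
`Q` is `G`-torsion-free and `G`-injective (i.e. `G`-closed) and the kernel and cokernel
of `R → Q` are `G`-torsion. -/
structure IsRingOfQuotients (Q : Type u) [CommRing Q] [Algebra R Q] : Prop where
  torsionFree : ∀ q : Q, Ideal.torsionOf R Q q ∈ G.sets → q = 0
  gInjective : ∀ J ∈ G.sets, ∀ f : ↥J →ₗ[R] Q, ∃ q : Q, ∀ j : ↥J, f j = (j : R) • q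
  ker_torsion : ∀ r : R, algebraMap R Q r = 0 → Ideal.torsionOf R R r ∈ G.sets
  coker_torsion : ∀ q : Q, ∃ J ∈ G.sets, ∀ x ∈ J, ∃ r : R, x • q = algebraMap R Q r

/-- `G` is a perfect Gabriel topology, realised by the perfect localisation `Q`:
`R → Q` is a flat ring epimorphism and `G = {J ∣ JQ = Q}`. -/
def IsPerfectLocalization (Q : Type u) [CommRing Q] [Algebra R Q] : Prop :=
  Module.Flat R Q ∧
  (∀ (S : Type u) [CommRing S] (f g : Q →+* S),
    f.comp (algebraMap R Q) = g.comp (algebraMap R Q) → f = g) ∧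
  (∀ J : Ideal R, J ∈ G.sets ↔ J • (⊤ : Submodule R Q) = ⊤)

end GabrielTopology

/-- A commutative ring is perfect iff every flat module is projective. -/
def IsPerfectRing (S : Type u) [CommRing S] : Prop :=
  ∀ (M : Type u) [AddCommGroup M] [Module S M], Module.Flat S M → Module.Projective S M

/-- `X` is Σ-pure-split: every pure embedding `A ⊆ B` with `B ∈ Add(X)` splits. -/
def SigmaPureSplit (R : Type u) [CommRing R] (X : Type u) [AddCommGroup X] [Module R X] : Prop :=
  ∀ (A B : Type u) [AddCommGroup A] [Module R A] [AddCommGroup B] [Module R B] (i : A →ₗ[R] B),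
    Function.Injective i →
    (∀ (M : Type u) [AddCommGroup M] [Module R M], Function.Injective (LinearMap.rTensor M i)) →
    InAdd R X B → ∃ r : B →ₗ[R] A, r ∘ₗ i = LinearMap.id

/-- A concrete model of `Ext¹_R(M, N)`, computed from the canonical free presentation
`0 → S → (M →₀ R) → M → 0` of `M` as `coker (Hom((M →₀ R), N) → Hom(S, N))`. -/
abbrev ext1 (R : Type u) [CommRing R] (M N : Type u) [AddCommGroup M] [Module R M]
    [AddCommGroup N] [Module R N] : Type u :=
  (↥(LinearMap.ker (Finsupp.linearCombination R (id : M → M))) →ₗ[R] N) ⧸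
    LinearMap.range
      (LinearMap.lcomp R N (LinearMap.ker (Finsupp.linearCombination R (id : M → M))).subtype)

/-- A concrete model of `Tor₁^R(M, N)`, computed from the canonical free presentation
`0 → S → (M →₀ R) → M → 0` of `M` as `ker (S ⊗ N → (M →₀ R) ⊗ N)`. -/
abbrev tor1 (R : Type u) [CommRing R] (M N : Type u) [AddCommGroup M] [Module R M]
    [AddCommGroup N] [Module R N] : Type u :=
  ↥(LinearMap.ker
    (LinearMap.rTensor N (LinearMap.ker (Finsupp.linearCombination R (id : M → M))).subtype))

/-- The cokernel `U/R` of a ring map `R → U`. -/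
abbrev cokerAlg (R U : Type u) [CommRing R] [CommRing U] [Algebra R U] : Type u :=
  U ⧸ LinearMap.range (Algebra.linearMap R U)

/-- A linear topology on a commutative ring `R`, given by its filter of open ideals. -/
structure LinearTopologyOn (R : Type u) [CommRing R] : Type u where
  sets : Set (Ideal R)
  top_mem : (⊤ : Ideal R) ∈ sets
  mem_of_le : ∀ {I J : Ideal R}, I ∈ sets → I ≤ J → J ∈ sets
  inf_mem : ∀ {I J : Ideal R}, I ∈ sets → J ∈ sets → I ⊓ J ∈ sets

/-- An `R`-module `M` is `H`-discrete if the annihilator of every element is open. -/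
def LinearTopologyOn.IsDiscrete {R : Type u} [CommRing R] (H : LinearTopologyOn R)
    (M : Type u) [AddCommGroup M] [Module R M] : Prop :=
  ∀ x : M, Ideal.torsionOf R M x ∈ H.sets

/-- `R` is `H`-h-local: every open ideal is contained in only finitely many maximal ideals,
and every open prime ideal is contained in only one maximal ideal. -/
def LinearTopologyOn.IsHLocal {R : Type u} [CommRing R] (H : LinearTopologyOn R) : Prop :=
  (∀ J ∈ H.sets, {m : Ideal R | m.IsMaximal ∧ J ≤ m}.Finite) ∧
  (∀ p ∈ H.sets, p.IsPrime →
    ∀ m n : Ideal R, m.IsMaximal → n.IsMaximal → p ≤ m → p ≤ n → m = n)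

/-- Over `S`, `M` admits a resolution of length `n` by finitely generated projectives. -/
def FGProjDimLE (S : Type u) [CommRing S] :
    ℕ → ∀ (M : Type u) [AddCommGroup M] [Module S M], Prop
  | 0, M, iA, iM =>
      letI := iA; letI := iM
      Module.Finite S M ∧ Module.Projective S M
  | n + 1, M, iA, iM =>
      letI := iA; letI := iM
      ∃ (k : ℕ) (f : (Fin k → S) →ₗ[S] M),
        Function.Surjective f ∧ FGProjDimLE S n ↥(LinearMap.ker f)

theorem Ext1Vanish.exists_lift {R C D E N : Type u} [CommRing R] [AddCommGroup C] [Module R C]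
    [AddCommGroup D] [Module R D] [AddCommGroup E] [Module R E] [AddCommGroup N] [Module R N]
    (h : Ext1Vanish R C D) (i : D →ₗ[R] E) (p : E →ₗ[R] N) (hi : Function.Injective i)
    (hp : Function.Surjective p) (hip : LinearMap.range i = LinearMap.ker p) (f : C →ₗ[R] N) :
    ∃ g : C →ₗ[R] E, p ∘ₗ g = f := by
  let P : Submodule R (E × C) :=
    LinearMap.eqLocus (p ∘ₗ LinearMap.fst R E C) (f ∘ₗ LinearMap.snd R E C)
  have hpi (d : D) : p (i d) = 0 := by
    rw [← LinearMap.mem_ker, ← hip]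
    exact ⟨d, rfl⟩
  let i' : D →ₗ[R] P := LinearMap.codRestrict P (LinearMap.prod i 0) fun d => by
    simp [P, LinearMap.mem_eqLocus, hpi]
  let p' : P →ₗ[R] C := LinearMap.snd R E C ∘ₗ P.subtype
  obtain ⟨s, hs⟩ := h P i' p'
    (fun a b hab => hi (congrArg (fun z : P => z.1.1) hab))
    (fun c => by
      obtain ⟨e, he⟩ := hp (f c)
      exact ⟨⟨(e, c), he⟩, rfl⟩)
    (by
      ext ⟨⟨e, c⟩, hec⟩
      constructor
      · rintro ⟨d, hd⟩
        exact (congrArg (fun z : P => z.1.2) hd).symm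
      · intro hc
        have hc : c = 0 := hc
        have he : e ∈ LinearMap.ker p := by
          have : p e = f c := hec
          simpa [hc] using this
        rw [← hip] at he
        obtain ⟨d, rfl⟩ := he
        exact ⟨d, Subtype.ext (Prod.ext rfl hc.symm)⟩)
  refine ⟨LinearMap.fst R E C ∘ₗ P.subtype ∘ₗ s, LinearMap.ext fun c => ?_⟩
  have h1 : p (s c).1.1 = f (s c).1.2 := (s c).2
  have h2 : (s c).1.2 = c := LinearMap.congr_fun hs c
  rw [h2] at h1
  exact h1

theorem Ext1Vanish.of_retract {R C B D : Type u} [CommRing R] [AddCommGroup C] [Module R C]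
    [AddCommGroup B] [Module R B] [AddCommGroup D] [Module R D] (h : Ext1Vanish R C D)
    (j : B →ₗ[R] C) (r : C →ₗ[R] B) (hr : r ∘ₗ j = LinearMap.id) : Ext1Vanish R B D := by
  intro E _ _ i p hi hp hip
  obtain ⟨g, hg⟩ := h.exists_lift i p hi hp hip r
  exact ⟨g ∘ₗ j, by rw [← LinearMap.comp_assoc, hg, hr]⟩

/-- The module generated by `b₀, b₁, …` subject to `s • bₖ₊₁ = bₖ`; a model of the localization
of `R` at the powers of `s`. -/
abbrev Telescope {R : Type u} [CommRing R] (s : R) : Type u :=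
  (ℕ →₀ R) ⧸ Submodule.span R (Set.range fun k : ℕ =>
    Finsupp.single k (1 : R) - s • Finsupp.single (k + 1) (1 : R))

namespace Telescope

variable {R : Type u} [CommRing R] (s : R)

/-- The generators of the telescope. -/
noncomputable def gen (k : ℕ) : Telescope s := Submodule.Quotient.mk (Finsupp.single k 1)

theorem smul_gen_succ (k : ℕ) : s • gen s (k + 1) = gen s k := by
  symm
  rw [gen, gen, ← Submodule.Quotient.mk_smul, Submodule.Quotient.eq]
  exact Submodule.subset_span ⟨k, rfl⟩

theorem hom_ext {N : Type*} [AddCommGroup N] [Module R N] {f g : Telescope s →ₗ[R] N}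
    (h : ∀ k, f (gen s k) = g (gen s k)) : f = g := by
  apply Submodule.linearMap_qext
  apply Finsupp.lhom_ext'
  intro k
  ext
  exact h k

theorem exists_lift {N : Type*} [AddCommGroup N] [Module R N] (x : ℕ → N)
    (hx : ∀ k, s • x (k + 1) = x k) : ∃ f : Telescope s →ₗ[R] N, ∀ k, f (gen s k) = x k := by
  refine ⟨Submodule.liftQ _ (Finsupp.linearCombination R x) ?_, fun k => ?_⟩
  · rw [Submodule.span_le]
    rintro _ ⟨k, rfl⟩
    simp [hx]
  · simp [gen, Submodule.liftQ_apply]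

theorem smul_bijective : Function.Bijective fun x : Telescope s => s • x := by
  obtain ⟨σ, hσ⟩ := exists_lift s (fun k => gen s (k + 1)) fun k => smul_gen_succ s (k + 1)
  have h : s • σ = LinearMap.id := hom_ext s fun k => by simp [hσ, smul_gen_succ]
  have h' (x) : s • σ x = x := LinearMap.congr_fun h x
  exact ⟨fun x y hxy => by
    rw [← h' x, ← h' y, ← map_smul, ← map_smul]; exact congrArg σ hxy, fun x => ⟨σ x, h' x⟩⟩

theorem pow_smul_gen (k : ℕ) : s ^ k • gen s k = gen s 0 := by
  induction k with
  | zero => simp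
  | succ k ih => rw [pow_succ, mul_smul, smul_gen_succ, ih]

end Telescope

namespace GabrielTopology

variable {R : Type u} [CommRing R] {G : GabrielTopology R}

theorem isOka_mem_sets : Ideal.IsOka (· ∈ G.sets) where
  top := G.top_mem
  oka {I a} h₁ h₂ := by
    refine G.gabriel I _ h₁ fun r hr => G.mem_of_le h₂ fun x hx => ?_
    rw [Ideal.mem_colon_span_singleton] at hx ⊢
    obtain ⟨y, hy, z, hz, rfl⟩ := Submodule.mem_sup.1 hr
    obtain ⟨w, rfl⟩ := Ideal.mem_span_singleton'.1 hz
    rw [mul_add]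
    refine I.add_mem (I.mul_mem_left _ hy) ?_
    rw [mul_left_comm]
    exact I.mul_mem_left _ hx

theorem FinitelyGenerated.exists_mem_of_sSup_mem (hG : G.FinitelyGenerated) {C : Set (Ideal R)}
    (hC : DirectedOn (· ≤ ·) C) (hne : C.Nonempty) (h : sSup C ∈ G.sets) :
    ∃ I ∈ C, I ∈ G.sets := by
  obtain ⟨J, hJ, hle, hfg⟩ := hG _ h
  have hfg := (Submodule.fg_iff_compact J).1 hfg
  rw [CompleteLattice.isCompactElement_iff_le_of_directed_sSup_le] at hfg
  obtain ⟨I, hI, hJI⟩ := hfg C hne hC hle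
  exact ⟨I, hI, G.mem_of_le hJ hJI⟩

theorem FinitelyGenerated.exists_isPrime (hG : G.FinitelyGenerated) {I : Ideal R}
    (hI : I ∉ G.sets) : ∃ p : Ideal R, p.IsPrime ∧ I ≤ p ∧ p ∉ G.sets := by
  obtain ⟨p, hIp, hp⟩ : ∃ p, I ≤ p ∧ Maximal (¬ · ∈ G.sets) p := by
    refine zorn_le_nonempty₀ {I | I ∉ G.sets} (fun C hC₁ hC₂ J hJ => ⟨sSup C, ?_, fun _ => le_sSup⟩)
      I hI
    intro h
    obtain ⟨K, hK, hK'⟩ := hG.exists_mem_of_sSup_mem hC₂.directedOn ⟨J, hJ⟩ h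
    exact hC₁ hK hK'
  exact ⟨p, isOka_mem_sets.isPrime_of_maximal_not hp, hIp, hp.prop⟩

/-- `φ` is an `𝒜`-cover. -/
structure IsACover (G : GabrielTopology R) {C M : Type u} [AddCommGroup C] [Module R C]
    [AddCommGroup M] [Module R M] (φ : C →ₗ[R] M) : Prop where
  memA : G.MemA C
  exists_lift : ∀ (C' : Type u) [AddCommGroup C'] [Module R C'], G.MemA C' →
    ∀ f : C' →ₗ[R] M, ∃ g : C' →ₗ[R] C, φ ∘ₗ g = f
  bijective : ∀ e : C →ₗ[R] C, φ ∘ₗ e = φ → Function.Bijective e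

theorem IsACovering.exists_isACover (hcov : G.IsACovering) (M : Type u) [AddCommGroup M]
    [Module R M] : ∃ (C : ModuleCat.{u} R) (φ : C →ₗ[R] M), G.IsACover φ := by
  obtain ⟨C, φ, h₁, h₂, h₃⟩ := hcov M
  exact ⟨C, φ, h₁, h₂, h₃⟩

theorem memA_self : G.MemA R := by
  intro D _ _ _ E _ _ i p hi hp hip
  obtain ⟨e, he⟩ := hp 1
  exact ⟨LinearMap.toSpanSingleton R E e, LinearMap.ext_ring (by simp [he])⟩

section Cover

variable {C M : Type u} [AddCommGroup C] [Module R C] [AddCommGroup M] [Module R M]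
  {φ : C →ₗ[R] M}

theorem IsACover.surjective (h : G.IsACover φ) : Function.Surjective φ := by
  intro m
  obtain ⟨g, hg⟩ := h.exists_lift R memA_self (LinearMap.toSpanSingleton R M m)
  exact ⟨g 1, by simpa using LinearMap.congr_fun hg 1⟩

/-- If `s` acts invertibly on `M`, it acts invertibly on every `𝒜`-cover of `M`. -/
theorem IsACover.smul_bijective (h : G.IsACover φ) {s : R}
    (hs : Function.Bijective fun x : M => s • x) : Function.Bijective fun x : C => s • x := by
  let σ : M ≃ₗ[R] M := LinearEquiv.ofBijective (LinearMap.lsmul R M s) hs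
  have hσ (x : M) : s • σ.symm x = x := σ.apply_symm_apply x
  obtain ⟨g, hg⟩ := h.exists_lift C h.memA (σ.symm.toLinearMap ∘ₗ φ)
  have hg' (x : C) : φ (g x) = σ.symm (φ x) := LinearMap.congr_fun hg x
  have hb := h.bijective (s • g) (LinearMap.ext fun x => by simp [hg', hσ])
  constructor
  · intro x y hxy
    apply hb.1
    simpa only [LinearMap.smul_apply, ← map_smul] using congrArg g hxy
  · intro x
    obtain ⟨y, hy⟩ := hb.2 x
    exact ⟨g y, hy⟩

end Cover

theorem IsACovering.memA_telescope (hcov : G.IsACovering) (s : R) : G.MemA (Telescope s) := by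
  obtain ⟨C, φ, h⟩ := hcov.exists_isACover (Telescope s)
  have hC := h.smul_bijective (Telescope.smul_bijective s)
  obtain ⟨c, hc⟩ := h.surjective (Telescope.gen s 0)
  choose σ hσ using hC.2
  obtain ⟨f, hf⟩ := Telescope.exists_lift s (fun k => σ^[k] c) fun k => by
    rw [Function.iterate_succ_apply']
    exact hσ _
  have hpow (k : ℕ) : s ^ k • f (Telescope.gen s k) = c := by
    rw [← map_smul, Telescope.pow_smul_gen, hf]
    rfl
  have hinj (k : ℕ) : Function.Injective fun x : Telescope s => s ^ k • x := by
    induction k with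
    | zero => intro x y; simp
    | succ k ih =>
      intro x y hxy
      simp only [pow_succ, mul_smul] at hxy
      exact (Telescope.smul_bijective s).1 (ih hxy)
  intro D _ _ hD
  refine (h.memA D hD).of_retract f φ (Telescope.hom_ext s fun k => hinj k ?_)
  simp only [LinearMap.comp_apply, LinearMap.id_apply]
  rw [← map_smul, hpow, hc, Telescope.pow_smul_gen]

theorem IsDivisible.finsupp {D : Type u} [AddCommGroup D] [Module R D] (hD : G.IsDivisible D) :
    G.IsDivisible (ℕ →₀ D) := by
  intro J hJ
  rw [eq_top_iff]
  intro x _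
  induction x using Finsupp.induction_linear with
  | zero => exact zero_mem _
  | add x y hx hy => exact add_mem (hx trivial) (hy trivial)
  | single i d =>
    have hd : d ∈ J • (⊤ : Submodule R D) := by rw [hD J hJ]; trivial
    have := Submodule.mem_map_of_mem (f := Finsupp.lsingle i) hd
    rw [Submodule.map_smul''] at this
    exact Submodule.smul_mono le_rfl le_top this

theorem IsACovering.exists_pow_smul (hcov : G.IsACovering) {D : Type u} [AddCommGroup D]
    [Module R D] (hD : G.IsDivisible D) (s : R) :
    ∃ n : ℕ, ∀ d : D, ∃ d' : D, s ^ n • d = s ^ (n + 1) • d' := by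
  by_contra! h
  choose d hd using h
  let i : (ℕ →₀ D) →ₗ[R] (ℕ → D) := Finsupp.lcoeFun
  let x (k : ℕ) : ℕ → D := fun n => if k ≤ n then s ^ (n - k) • d n else 0
  obtain ⟨f, hf⟩ := Telescope.exists_lift s
    (fun k => (Submodule.Quotient.mk (x k) : (ℕ → D) ⧸ LinearMap.range i)) fun k => by
    symm
    rw [← Submodule.Quotient.mk_smul, Submodule.Quotient.eq]
    refine ⟨Finsupp.single k (d k), funext fun n => ?_⟩
    change Finsupp.single k (d k) n = x k n - s • x (k + 1) n
    rcases lt_trichotomy k n with hk | rfl | hk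
    · obtain ⟨m, rfl⟩ := Nat.exists_eq_add_of_lt hk
      have h1 : k + m + 1 - k = m + 1 := by omega
      have h2 : k + m + 1 - (k + 1) = m := by omega
      simp [x, h1, h2, hk.le, hk.ne, Nat.succ_le_of_lt hk, smul_smul, ← pow_succ']
    · simp [x]
    · have h1 : ¬ k ≤ n := by omega
      have h2 : ¬ k + 1 ≤ n := by omega
      simp [x, h1, h2, hk.ne']
  have hi : Function.Injective i := DFunLike.coe_injective
  obtain ⟨g, hg⟩ := (hcov.memA_telescope s _ hD.finsupp).exists_lift i (LinearMap.range i).mkQ hi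
    (Submodule.mkQ_surjective _) (Submodule.ker_mkQ _).symm f
  have h0 : (Submodule.Quotient.mk (g (Telescope.gen s 0)) : (ℕ → D) ⧸ LinearMap.range i) =
      Submodule.Quotient.mk (x 0) := (LinearMap.congr_fun hg _).trans (hf 0)
  rw [Submodule.Quotient.eq] at h0
  obtain ⟨w, hw⟩ := h0
  obtain ⟨n, hn⟩ := Infinite.exists_notMem_finset w.support
  have hn' : w n = g (Telescope.gen s 0) n - x 0 n := congrFun hw n
  rw [Finsupp.notMem_support_iff.1 hn, eq_comm, sub_eq_zero] at hn'
  refine hd n (g (Telescope.gen s (n + 1)) n) ?_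
  rw [← Pi.smul_apply (s ^ (n + 1)), ← map_smul, Telescope.pow_smul_gen, hn']
  simp [x]

end GabrielTopology

theorem exists_linearMap_of_rel {R A B : Type*} [CommRing R] [AddCommGroup A] [Module R A]
    [AddCommGroup B] [Module R B] (ρ : A → B → Prop) (hex : ∀ a, ∃ b, ρ a b)
    (huniq : ∀ b, ρ 0 b → b = 0)
    (hadd : ∀ a a' b b', ρ a b → ρ a' b' → ρ (a + a') (b + b'))
    (hsmul : ∀ (r : R) a b, ρ a b → ρ (r • a) (r • b)) :
    ∃ f : A →ₗ[R] B, ∀ a b, ρ a b ↔ f a = b := by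
  have huniq' (a b b') (h : ρ a b) (h' : ρ a b') : b = b' := by
    have := hadd _ _ _ _ h (hsmul (-1) _ _ h')
    rw [neg_one_smul, neg_one_smul, add_neg_cancel] at this
    exact add_neg_eq_zero.1 (huniq _ this)
  choose f hf using hex
  exact ⟨{ toFun := f
           map_add' := fun a b => huniq' _ _ _ (hf _) (hadd _ _ _ _ (hf a) (hf b))
           map_smul' := fun r a => huniq' _ _ _ (hf _) (hsmul r _ _ (hf a)) },
    fun a b => ⟨fun h => huniq' _ _ _ (hf a) h, fun h => h ▸ hf a⟩⟩

namespace GabrielTopology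

variable {R : Type u} [CommRing R] {G : GabrielTopology R}

theorem isDivisible_localization {p : Ideal R} [p.IsPrime] (hp : p ∉ G.sets) :
    G.IsDivisible (Localization.AtPrime p) := by
  intro J hJ
  obtain ⟨j, hj, hjp⟩ := SetLike.not_le_iff_exists.1 fun h : J ≤ p => hp (G.mem_of_le hJ h)
  rw [eq_top_iff]
  intro x _
  obtain ⟨u, hu⟩ := IsLocalization.map_units (Localization.AtPrime p) (⟨j, hjp⟩ : p.primeCompl)
  have hx : x = j • ((↑u⁻¹ : Localization.AtPrime p) * x) := by
    rw [Algebra.smul_def]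
    change x = algebraMap R _ (⟨j, hjp⟩ : p.primeCompl) * _
    rw [← hu, Units.mul_inv_cancel_left]
  rw [hx]
  exact Submodule.smul_mem_smul hj trivial

theorem IsACovering.exists_sup_mem (hcov : G.IsACovering) (hG : G.FinitelyGenerated) (s : R) :
    ∃ n : ℕ, n ≠ 0 ∧ Ideal.span {s ^ (2 * n)} ⊔ Ideal.torsionOf R R (s ^ n) ∈ G.sets := by
  have hmono : Monotone fun n => Ideal.span {s} ⊔ Ideal.torsionOf R R (s ^ n) := by
    refine monotone_nat_of_le_succ fun n => sup_le_sup_left (fun x hx => ?_) _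
    rw [Ideal.mem_torsionOf_iff, smul_eq_mul] at hx ⊢
    rw [pow_succ, ← mul_assoc, hx, zero_mul]
  have hmem : sSup (Set.range fun n => Ideal.span {s} ⊔ Ideal.torsionOf R R (s ^ n)) ∈ G.sets := by
    by_contra h
    obtain ⟨p, hp, hle, hpG⟩ := hG.exists_isPrime h
    rw [sSup_range, iSup_le_iff] at hle
    obtain ⟨n, hn⟩ := hcov.exists_pow_smul (isDivisible_localization hpG) s
    obtain ⟨d, hd⟩ := hn 1
    have hs : s ∈ p := hle 0 (Submodule.mem_sup_left (Ideal.mem_span_singleton_self s))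
    have hnon : algebraMap R (Localization.AtPrime p) s * d ∈ nonunits _ := fun hu =>
      (IsLocalization.AtPrime.isUnit_to_map_iff (Localization.AtPrime p) p s).1
        (isUnit_of_mul_isUnit_left hu) hs
    have h0 : algebraMap R (Localization.AtPrime p) (s ^ n) = 0 := by
      have hunit := IsLocalRing.isUnit_one_sub_self_of_mem_nonunits _ hnon
      rw [← hunit.mul_left_eq_zero]
      simp only [Algebra.smul_def, map_pow] at hd ⊢
      linear_combination hd
    obtain ⟨⟨u, hu⟩, hu'⟩ := (IsLocalization.map_eq_zero_iff p.primeCompl _ _).1 h0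
    exact hu (hle n (Submodule.mem_sup_right hu'))
  obtain ⟨_, ⟨n, rfl⟩, hn⟩ := hG.exists_mem_of_sSup_mem (hmono.directed_le.directedOn_range)
    (Set.range_nonempty _) hmem
  refine ⟨n + 1, n.succ_ne_zero, ?_⟩
  by_contra h
  obtain ⟨p, hp, hle, hpG⟩ := hG.exists_isPrime h
  refine hpG (G.mem_of_le (G.mem_of_le hn (hmono n.le_succ)) (sup_le ?_ (le_sup_right.trans hle)))
  rw [Ideal.span_singleton_le_iff_mem]
  exact hp.mem_of_pow_mem _ (hle (Submodule.mem_sup_left (Ideal.mem_span_singleton_self _)))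

theorem FinitelyGenerated.span_pow_mem (hG : G.FinitelyGenerated) {S : Set R}
    (hS : Ideal.span S ∈ G.sets) (n : R → ℕ) :
    Ideal.span ((fun s => s ^ n s) '' S) ∈ G.sets := by
  by_contra h
  obtain ⟨p, hp, hle, hpG⟩ := hG.exists_isPrime h
  refine hpG (G.mem_of_le hS (Ideal.span_le.2 fun s hs => ?_))
  exact hp.mem_of_pow_mem (n s) (hle (Ideal.subset_span ⟨s, hs, rfl⟩))

section RingOfQuotients

variable {Q : Type u} [CommRing Q] [Algebra R Q]

theorem IsRingOfQuotients.exists_pow_eq (hQ : G.IsRingOfQuotients Q) (hF : G.Faithful)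
    (hG : G.FinitelyGenerated) (hcov : G.IsACovering) (s : R) :
    ∃ n : ℕ, n ≠ 0 ∧ ∃ t : Q, algebraMap R Q (s ^ n) = s ^ (2 * n) • t := by
  obtain ⟨n, hn0, hn⟩ := hcov.exists_sup_mem hG s
  refine ⟨n, hn0, ?_⟩
  set J := Ideal.span {s ^ (2 * n)} ⊔ Ideal.torsionOf R R (s ^ n)
  obtain ⟨f, hf⟩ := exists_linearMap_of_rel (R := R)
    (fun (x : J) (y : R) => (∃ a, y = a * s ^ n) ∧ (x : R) * s ^ n = y * s ^ (2 * n))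
    (by
      rintro ⟨x, hx⟩
      obtain ⟨y, hy, b, hb, rfl⟩ := Submodule.mem_sup.1 hx
      obtain ⟨a, rfl⟩ := Ideal.mem_span_singleton'.1 hy
      rw [Ideal.mem_torsionOf_iff, smul_eq_mul] at hb
      refine ⟨a * s ^ n, ⟨a, rfl⟩, ?_⟩
      linear_combination hb)
    (by
      rintro _ ⟨⟨c, rfl⟩, hc⟩
      refine hF _ (G.mem_of_le hn (sup_le ?_ fun b hb => ?_))
      · rw [Ideal.span_singleton_le_iff_mem, Ideal.mem_torsionOf_iff, smul_eq_mul]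
        simp only [ZeroMemClass.coe_zero, zero_mul] at hc
        linear_combination -hc
      · rw [Ideal.mem_torsionOf_iff, smul_eq_mul] at hb ⊢
        linear_combination c * hb)
    (by
      rintro x x' _ _ ⟨⟨a, rfl⟩, h⟩ ⟨⟨a', rfl⟩, h'⟩
      refine ⟨⟨a + a', by ring⟩, ?_⟩
      rw [Submodule.coe_add]
      linear_combination h + h')
    (by
      rintro r x _ ⟨⟨a, rfl⟩, h⟩
      refine ⟨⟨r * a, by rw [smul_eq_mul]; ring⟩, ?_⟩
      rw [Submodule.coe_smul, smul_eq_mul, smul_eq_mul]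
      linear_combination r * h)
  obtain ⟨t, ht⟩ := hQ.gInjective J hn (Algebra.linearMap R Q ∘ₗ f)
  have hmem : s ^ (2 * n) ∈ J := Submodule.mem_sup_left (Ideal.mem_span_singleton_self _)
  refine ⟨t, ?_⟩
  rw [← ht ⟨_, hmem⟩, LinearMap.comp_apply, (hf ⟨_, hmem⟩ (s ^ n)).1 ⟨⟨1, by simp⟩, mul_comm _ _⟩]
  rfl

theorem IsRingOfQuotients.exists_sum_eq_one (hQ : G.IsRingOfQuotients Q)
    (hG : G.FinitelyGenerated) {S : Finset R} (hS : Ideal.span (S : Set R) ∈ G.sets) {n : R → ℕ}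
    {t : R → Q} (ht : ∀ s, algebraMap R Q (s ^ n s) = s ^ (2 * n s) • t s) :
    ∃ q : S → Q, ∑ s : S, (s : R) ^ n s • q s = 1 := by
  set I : Ideal Q := Ideal.span ((fun s => algebraMap R Q (s ^ n s)) '' S)
  set P : Q := ∏ s ∈ S, (1 - s ^ n s • t s)
  have hP : P = 0 := by
    refine hQ.torsionFree _ (G.mem_of_le (hG.span_pow_mem hS n) (Ideal.span_le.2 ?_))
    rintro _ ⟨s, hs, rfl⟩
    rw [SetLike.mem_coe, Ideal.mem_torsionOf_iff]
    have h0 : algebraMap R Q (s ^ n s) * (1 - s ^ n s • t s) = 0 := by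
      have := ht s
      rw [two_mul, pow_add, Algebra.smul_def, map_mul] at this
      rw [Algebra.smul_def]
      linear_combination this
    rw [Algebra.smul_def]
    simp only [P]
    classical
    rw [← Finset.mul_prod_erase S _ hs, ← mul_assoc, h0, zero_mul]
  have hmk : Ideal.Quotient.mk I P = 1 := by
    simp only [P, map_prod]
    refine Finset.prod_eq_one fun s hs => ?_
    rw [map_sub, map_one, Algebra.smul_def, map_mul,
      Ideal.Quotient.eq_zero_iff_mem.2 (show algebraMap R Q (s ^ n s) ∈ I from Ideal.subset_span ⟨s, hs, rfl⟩),
      zero_mul, sub_zero]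
  have h1 : (1 : Q) ∈ I := by
    rw [← Ideal.Quotient.eq_zero_iff_mem, map_one, ← hmk, hP, map_zero]
  obtain ⟨q, hq⟩ := (Submodule.mem_span_image_finset_iff_exists_fun Q).1 h1
  refine ⟨q, ?_⟩
  rw [← hq]
  exact Finset.sum_congr rfl fun s _ => by rw [Algebra.smul_def, smul_eq_mul, mul_comm]

end RingOfQuotients

end GabrielTopology

namespace GabrielTopology

variable {R : Type u} [CommRing R] {G : GabrielTopology R}
  {Q : Type u} [CommRing Q] [Algebra R Q]

theorem IsRingOfQuotients.isDivisible (hQ : G.IsRingOfQuotients Q) (hF : G.Faithful)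
    (hG : G.FinitelyGenerated) (hcov : G.IsACovering) : G.IsDivisible Q := by
  intro J hJ
  choose n hn0 t ht using hQ.exists_pow_eq hF hG hcov
  obtain ⟨_, hS, hSJ, S, rfl⟩ := hG J hJ
  obtain ⟨q, hq⟩ := hQ.exists_sum_eq_one hG hS ht
  rw [eq_top_iff]
  intro x _
  rw [← one_mul x, ← hq, Finset.sum_mul]
  refine sum_mem fun s _ => ?_
  rw [smul_mul_assoc]
  exact Submodule.smul_mem_smul
    (J.pow_mem_of_mem (hSJ (Ideal.subset_span s.2)) _ (Nat.pos_of_ne_zero (hn0 _))) trivial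

section Module

variable {W : Type u} [AddCommGroup W] [Module R W] [Module Q W] [IsScalarTower R Q W]

theorem IsDivisible.of_isScalarTower (hQ : G.IsDivisible Q) (W : Type u) [AddCommGroup W]
    [Module R W] [Module Q W] [IsScalarTower R Q W] : G.IsDivisible W := by
  intro J hJ
  have h (q : Q) (w : W) (hq : q ∈ J • (⊤ : Submodule R Q)) :
      q • w ∈ J • (⊤ : Submodule R W) := by
    induction hq using Submodule.smul_induction_on' with
    | smul r hr q _ => rw [smul_assoc]; exact Submodule.smul_mem_smul hr trivial
    | add x _ y _ hx hy => rw [add_smul]; exact add_mem hx hy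
  rw [eq_top_iff]
  intro w _
  rw [← one_smul Q w]
  exact h 1 w (by rw [hQ J hJ]; trivial)

theorem IsDivisible.isTorsionFree (hQ : G.IsDivisible Q) (W : Type u) [AddCommGroup W]
    [Module R W] [Module Q W] [IsScalarTower R Q W] : G.IsTorsionFree W := by
  intro w hw
  have h (q : Q) (hq : q ∈ Ideal.torsionOf R W w • (⊤ : Submodule R Q)) : q • w = 0 := by
    induction hq using Submodule.smul_induction_on' with
    | smul r hr q _ =>
      rw [Ideal.mem_torsionOf_iff] at hr
      rw [smul_assoc, ← algebraMap_smul Q r (q • w), smul_comm, algebraMap_smul, hr, smul_zero]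
    | add x _ y _ hx hy => rw [add_smul, hx, hy, add_zero]
  rw [← one_smul Q w]
  exact h 1 (by rw [hQ _ hw]; trivial)

/-- The kernel of an `R`-linear map from an `R_G`-module to a torsion-free module is stable under
the action of `R_G`. -/
theorem IsRingOfQuotients.map_smul_eq_zero (hQ : G.IsRingOfQuotients Q) {N : Type u}
    [AddCommGroup N] [Module R N] (hN : G.IsTorsionFree N) (f : W →ₗ[R] N) (q : Q) {x : W}
    (hx : f x = 0) : f (q • x) = 0 := by
  obtain ⟨J, hJ, hq⟩ := hQ.coker_torsion q
  refine hN _ (G.mem_of_le hJ fun r hr => ?_)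
  obtain ⟨a, ha⟩ := hq r hr
  rw [Ideal.mem_torsionOf_iff, ← map_smul, ← smul_assoc, ha, algebraMap_smul, map_smul, hx,
    smul_zero]

theorem IsRingOfQuotients.map_smul (hQ : G.IsRingOfQuotients Q) {N : Type u} [AddCommGroup N]
    [Module R N] [Module Q N] [IsScalarTower R Q N] (hN : G.IsTorsionFree N) (f : W →ₗ[R] N)
    (q : Q) (x : W) : f (q • x) = q • f x := by
  obtain ⟨J, hJ, hq⟩ := hQ.coker_torsion q
  rw [← sub_eq_zero]
  refine hN _ (G.mem_of_le hJ fun r hr => ?_)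
  obtain ⟨a, ha⟩ := hq r hr
  rw [Ideal.mem_torsionOf_iff, smul_sub, ← LinearMap.map_smul, ← smul_assoc, ← smul_assoc, ha,
    algebraMap_smul, algebraMap_smul, LinearMap.map_smul, sub_self]

end Module

/-- Torsion-free divisible modules receive an `R`-linear map from `R_G` through every element. -/
theorem IsRingOfQuotients.exists_linearMap (hQ : G.IsRingOfQuotients Q) (hF : G.Faithful)
    {C : Type u} [AddCommGroup C] [Module R C] (hC : G.IsTorsionFree C) (hC' : G.IsDivisible C)
    (c : C) : ∃ f : Q →ₗ[R] C, f 1 = c := by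
  have hinj (a : R) (ha : algebraMap R Q a = 0) : a = 0 := hF a (hQ.ker_torsion a ha)
  obtain ⟨f, hf⟩ := exists_linearMap_of_rel (R := R)
    (fun (q : Q) (y : C) => ∃ J ∈ G.sets, ∀ r ∈ J, ∃ a : R, r • q = algebraMap R Q a ∧
      r • y = a • c)
    (by
      intro q
      obtain ⟨J, hJ, hq⟩ := hQ.coker_torsion q
      have h (c : C) (hc : c ∈ J • (⊤ : Submodule R C)) :
          ∃ y : C, ∀ r ∈ J, ∀ a : R, r • q = algebraMap R Q a → r • y = a • c := by
        induction hc using Submodule.smul_induction_on' with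
        | smul j hj c _ =>
          obtain ⟨b, hb⟩ := hq j hj
          refine ⟨b • c, fun r _ a ha => ?_⟩
          have : r * b = a * j := by
            rw [← sub_eq_zero]
            refine hinj _ ?_
            rw [map_sub, map_mul, map_mul, ← ha, ← hb, Algebra.smul_def, Algebra.smul_def]
            ring
          rw [smul_smul, smul_smul, this]
        | add x _ y _ hx hy =>
          obtain ⟨x', hx⟩ := hx
          obtain ⟨y', hy⟩ := hy
          exact ⟨x' + y', fun r hr a ha => by rw [smul_add, smul_add, hx r hr a ha, hy r hr a ha]⟩
      obtain ⟨y, hy⟩ := h c (by rw [hC' J hJ]; trivial)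
      refine ⟨y, J, hJ, fun r hr => ?_⟩
      obtain ⟨a, ha⟩ := hq r hr
      exact ⟨a, ha, hy r hr a ha⟩)
    (by
      rintro y ⟨J, hJ, h⟩
      refine hC y (G.mem_of_le hJ fun r hr => ?_)
      obtain ⟨a, ha, hay⟩ := h r hr
      rw [smul_zero] at ha
      rw [Ideal.mem_torsionOf_iff, hay, hinj a ha.symm, zero_smul])
    (by
      rintro q q' y y' ⟨J, hJ, h⟩ ⟨J', hJ', h'⟩
      refine ⟨J ⊓ J', G.inf_mem hJ hJ', fun r hr => ?_⟩
      obtain ⟨a, ha, hay⟩ := h r hr.1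
      obtain ⟨a', ha', hay'⟩ := h' r hr.2
      exact ⟨a + a', by rw [smul_add, ha, ha', map_add], by rw [smul_add, hay, hay', add_smul]⟩)
    (by
      rintro b q y ⟨J, hJ, h⟩
      refine ⟨J, hJ, fun r hr => ?_⟩
      obtain ⟨a, ha, hay⟩ := h r hr
      exact ⟨b * a, by rw [smul_comm, ha, map_mul, Algebra.smul_def],
        by rw [smul_comm, hay, mul_smul]⟩)
  exact ⟨f, (hf 1 c).1 ⟨⊤, G.top_mem, fun r _ => ⟨r, by rw [Algebra.smul_def, mul_one], rfl⟩⟩⟩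

theorem IsRingOfQuotients.isTorsionFree_and_isDivisible_of_isACover (hQ : G.IsRingOfQuotients Q)
    (hF : G.Faithful) (hG : G.FinitelyGenerated) (hcov : G.IsACovering) {C W : Type u}
    [AddCommGroup C] [Module R C] [AddCommGroup W] [Module R W] [Module Q W] [IsScalarTower R Q W]
    {φ : C →ₗ[R] W} (hφ : G.IsACover φ) : G.IsTorsionFree C ∧ G.IsDivisible C := by
  choose n hn0 t ht using hQ.exists_pow_eq hF hG hcov
  have key (S : Finset R) (hS : Ideal.span (S : Set R) ∈ G.sets) :
      (∀ c : C, (∀ s ∈ S, s • c = 0) → c = 0) ∧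
        Ideal.span (S : Set R) • (⊤ : Submodule R C) = ⊤ := by
    obtain ⟨q, hq⟩ := hQ.exists_sum_eq_one hG hS ht
    let M (s : R) : Submodule R W := LinearMap.range (LinearMap.lsmul R W (s ^ n s))
    have hM (s : R) : Function.Bijective fun x : M s => s • x := by
      have hinv (x : W) : s ^ n s • x = s ^ (2 * n s) • t s • x := by
        rw [← smul_assoc, ← ht, algebraMap_smul]
      obtain ⟨m, hm⟩ := Nat.exists_eq_add_one_of_ne_zero (hn0 s)
      constructor
      · refine (injective_iff_map_eq_zero (LinearMap.lsmul R (M s) s)).2 ?_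
        rintro ⟨_, x, rfl⟩ hx
        have hx : s • s ^ n s • x = 0 := congrArg Subtype.val hx
        have h0 : s ^ (2 * n s) • x = 0 := by
          have : s ^ (2 * n s) = s ^ m * (s * s ^ n s) := by rw [hm]; ring
          rw [this, mul_smul, mul_smul, hx, smul_zero]
        refine Subtype.ext ?_
        change s ^ n s • x = 0
        rw [hinv, ← algebraMap_smul Q (s ^ (2 * n s)) (t s • x), smul_comm, algebraMap_smul, h0,
          smul_zero]
      · rintro ⟨_, x, rfl⟩
        refine ⟨⟨_, s ^ m • t s • x, rfl⟩, Subtype.ext ?_⟩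
        change s • s ^ n s • s ^ m • t s • x = s ^ n s • x
        rw [hinv x, smul_smul, smul_smul]
        congr 1
        rw [hm]
        ring
    choose D ψ hψ using fun s : R => hcov.exists_isACover (M s)
    have hD (s : R) := (hψ s).smul_bijective (hM s)
    choose g hg using fun s : S => (hψ s).exists_lift C hφ.memA
      ((LinearMap.lsmul R W ((s : R) ^ n s)).rangeRestrict ∘ₗ Algebra.lsmul R R W (q s) ∘ₗ φ)
    choose f hf using fun s : S => hφ.exists_lift (D s) (hψ s).memA ((M s).subtype ∘ₗ ψ s)
    have hfg (s : S) (c : C) : φ (f s (g s c)) = ((s : R) ^ n s • q s) • φ c := by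
      have h1 : φ (f s (g s c)) = (ψ s (g s c) : W) := LinearMap.congr_fun (hf s) _
      have h2 : (ψ s (g s c) : W) = (s : R) ^ n s • q s • φ c :=
        congrArg Subtype.val (LinearMap.congr_fun (hg s) c)
      rw [h1, h2, smul_assoc]
    have hb := hφ.bijective (∑ s : S, f s ∘ₗ g s) (LinearMap.ext fun c => by
      simp only [LinearMap.comp_apply, LinearMap.sum_apply, map_sum, hfg]
      rw [← Finset.sum_smul, hq, one_smul])
    constructor
    · intro c hc
      apply hb.1
      rw [map_zero, LinearMap.sum_apply]
      refine Finset.sum_eq_zero fun s _ => ?_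
      have : g s c = 0 := (hD s).1 (by
        change (s : R) • g s c = (s : R) • 0
        rw [← LinearMap.map_smul, hc s s.2, map_zero, smul_zero])
      rw [LinearMap.comp_apply, this, map_zero]
    · rw [eq_top_iff]
      intro c _
      obtain ⟨c, rfl⟩ := hb.2 c
      rw [LinearMap.sum_apply]
      refine sum_mem fun s _ => ?_
      obtain ⟨d, hd⟩ := (hD s).2 (g s c)
      have hd : (s : R) • d = g s c := hd
      rw [LinearMap.comp_apply, ← hd, LinearMap.map_smul]
      exact Submodule.smul_mem_smul (Ideal.subset_span s.2) trivial
  constructor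
  · intro c hc
    obtain ⟨_, hS, hSJ, S, rfl⟩ := hG _ hc
    exact (key S hS).1 c fun s hs => hSJ (Ideal.subset_span hs)
  · intro J hJ
    obtain ⟨_, hS, hSJ, S, rfl⟩ := hG J hJ
    exact top_unique ((key S hS).2.ge.trans (Submodule.smul_mono_left hSJ))

/-- An element of the kernel of a map from a free module onto a flat one is fixed by an
endomorphism with values in the kernel. -/
theorem exists_fixing_of_flat {S X F : Type*} [CommRing S] [AddCommGroup F] [Module S F]
    [Module.Flat S F] (p : (X →₀ S) →ₗ[S] F) (hp : Function.Surjective p) {z : X →₀ S}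
    (hz : p z = 0) : ∃ θ : (X →₀ S) →ₗ[S] (X →₀ S), p ∘ₗ θ = 0 ∧ θ z = z := by
  let ρ : (X →₀ S) →ₗ[S] (z.support →₀ S) := Finsupp.lsubtypeDomain (z.support : Set X)
  let ι : (z.support →₀ S) →ₗ[S] (X →₀ S) := Finsupp.lmapDomain S S Subtype.val
  have hιρ : ι (ρ z) = z := by
    ext x
    by_cases hx : x ∈ z.support
    · exact Finsupp.mapDomain_apply Subtype.val_injective _ (⟨x, hx⟩ : z.support)
    · rw [Finsupp.notMem_support_iff.1 hx]
      exact Finsupp.mapDomain_of_notMem_range _ _ fun ⟨y, hy⟩ => hx (hy ▸ y.2)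
  obtain ⟨k, a, y, hy, ha⟩ := Module.Flat.exists_factorization_of_apply_eq_zero_of_free
    (f := ρ z) (x := p ∘ₗ ι) (by rw [LinearMap.comp_apply, hιρ, hz])
  obtain ⟨y', hy'⟩ := Module.projective_lifting_property p y hp
  refine ⟨(ι - y' ∘ₗ a) ∘ₗ ρ, ?_, ?_⟩
  · rw [← LinearMap.comp_assoc, LinearMap.comp_sub, hy, ← LinearMap.comp_assoc, hy', sub_self,
      LinearMap.zero_comp]
  · simp [ha, hιρ]

theorem IsRingOfQuotients.projective_of_flat (hQ : G.IsRingOfQuotients Q) (hF : G.Faithful)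
    (hG : G.FinitelyGenerated) (hcov : G.IsACovering) (W : Type u) [AddCommGroup W] [Module R W]
    [Module Q W] [IsScalarTower R Q W] [Module.Flat Q W] : Module.Projective Q W := by
  have hdiv := hQ.isDivisible hF hG hcov
  have hWtf := hdiv.isTorsionFree W
  obtain ⟨C, φ, hφ⟩ := hcov.exists_isACover W
  obtain ⟨hCtf, hCdiv⟩ := hQ.isTorsionFree_and_isDivisible_of_isACover hF hG hcov hφ
  choose m hm using hQ.exists_linearMap hF hCtf hCdiv
  let π : (C →₀ Q) →ₗ[R] C := Finsupp.lsum R m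
  have hπ : Function.Surjective π := fun c => ⟨Finsupp.single c 1, by simp [π, hm]⟩
  let K : Submodule Q (C →₀ Q) :=
    { carrier := {x | π x = 0}
      zero_mem' := map_zero π
      add_mem' := fun {a b} ha hb => by
        change π (a + b) = 0
        rw [map_add, show π a = 0 from ha, show π b = 0 from hb, add_zero]
      smul_mem' := fun q x hx => hQ.map_smul_eq_zero hCtf π q hx }
  obtain ⟨s, hs⟩ := hφ.memA K (hdiv.of_isScalarTower K) _ (K.subtype.restrictScalars R) π
    K.injective_subtype hπ (by ext x; exact ⟨fun ⟨k, hk⟩ => hk ▸ k.2, fun hx => ⟨⟨x, hx⟩, rfl⟩⟩)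
  have hs' (c : C) : π (s c) = c := LinearMap.congr_fun hs c
  let p : (C →₀ Q) →ₗ[Q] W :=
    { toFun := φ ∘ₗ π
      map_add' := map_add _
      map_smul' := fun q x => hQ.map_smul hWtf (φ ∘ₗ π) q x }
  have hp (x) : p x = φ (π x) := rfl
  have hpsurj : Function.Surjective p := hφ.surjective.comp hπ
  have hφinj : Function.Injective φ := by
    rw [← LinearMap.ker_eq_bot, eq_bot_iff]
    intro k hk
    obtain ⟨θ, hθ, hθk⟩ := exists_fixing_of_flat p hpsurj (z := s k) (by rw [hp, hs']; exact hk)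
    have hb := hφ.bijective (LinearMap.id - π ∘ₗ θ.restrictScalars R ∘ₗ s) (by
      ext c
      have : φ (π (θ (s c))) = 0 := LinearMap.congr_fun hθ (s c)
      simp [this])
    exact hb.1 (by simp [hθk, hs'])
  let e : C ≃ₗ[R] W := LinearEquiv.ofBijective φ ⟨hφinj, hφ.surjective⟩
  let j : W →ₗ[Q] (C →₀ Q) :=
    { toFun := s ∘ₗ e.symm.toLinearMap
      map_add' := map_add _
      map_smul' := fun q x => hQ.map_smul (hdiv.isTorsionFree _) (s ∘ₗ e.symm.toLinearMap) q x }
  refine Module.Projective.of_split j p (LinearMap.ext fun w => ?_)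
  change φ (π (s (e.symm w))) = w
  rw [hs']
  exact e.apply_symm_apply w

end GabrielTopology

theorem stmt3 (R : Type u) [CommRing R] (G : GabrielTopology R)
    (hG : G.IsTiltingTopology) (hcov : G.IsACovering) :
    ∀ (Q : Type u) [CommRing Q] [Algebra R Q], G.IsRingOfQuotients Q → IsPerfectRing Q := by
  intro Q _ _ hQ W _ _ _
  let : Module R W := Module.compHom W (algebraMap R Q)
  have : IsScalarTower R Q W := .of_algebraMap_smul fun _ _ => rfl
  exact hQ.projective_of_flat hG.1 hG.2.1 hcov W
end

section
/- Let R be a commutative ring and (A, D_G) a 1-tilting cotorsion pair with associated Gabriel topology G such that A is a covering class. If F is a Bass R-module, i.e. F = lim→(R →·a_1 R →·a_2 R → ⋯) for a sequence of elements a_1, a_2, … of R, then for every J ∈ G the R/J-module R/J ⊗_R F has a projective cover over the ring R/J. -/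
universe u

namespace GabrielTopology

variable {R : Type u} [CommRing R] {G : GabrielTopology R}
  {M N D : Type u} [AddCommGroup M] [Module R M] [AddCommGroup N] [Module R N]
  [AddCommGroup D] [Module R D]

theorem IsDivisible.of_surjective (h : G.IsDivisible M) (f : M →ₗ[R] N)
    (hf : Function.Surjective f) : G.IsDivisible N := by
  intro J hJ
  have := congrArg (Submodule.map f) (h J hJ)
  rwa [Submodule.map_smul'', Submodule.map_top, LinearMap.range_eq_top.2 hf] at this

theorem IsDivisible.finsupp_s4 {ι : Type} (h : G.IsDivisible M) : G.IsDivisible (ι →₀ M) := by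
  intro J hJ
  rw [eq_top_iff]
  rintro x -
  induction x using Finsupp.induction_linear with
  | zero => exact zero_mem _
  | add f g hf hg => exact add_mem hf hg
  | single i m =>
    have hm : m ∈ J • (⊤ : Submodule R M) := by rw [h J hJ]; trivial
    have := Submodule.mem_map_of_mem (f := Finsupp.lsingle (R := R) i) hm
    rw [Submodule.map_smul''] at this
    exact Submodule.smul_mono le_rfl le_top this

/-- Maps from a module in `𝒜` lift along epimorphisms with `G`-divisible kernel. -/
theorem MemA.exists_lift (hM : G.MemA M) {E Y : Type u} [AddCommGroup E] [Module R E]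
    [AddCommGroup Y] [Module R Y] (p : E →ₗ[R] Y) (hp : Function.Surjective p)
    (hker : G.IsDivisible (LinearMap.ker p)) (f : M →ₗ[R] Y) :
    ∃ g : M →ₗ[R] E, p ∘ₗ g = f := by
  let P : Submodule R (E × M) :=
    LinearMap.eqLocus (p ∘ₗ LinearMap.fst R E M) (f ∘ₗ LinearMap.snd R E M)
  have hP : ∀ z : P, p z.1.1 = f z.1.2 := fun z => z.2
  let i : LinearMap.ker p →ₗ[R] P :=
    (LinearMap.inl R E M ∘ₗ (LinearMap.ker p).subtype).codRestrict P fun z => by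
      change p z.1 = f 0
      rw [map_zero]
      exact z.2
  obtain ⟨s, hs⟩ := hM (LinearMap.ker p) hker P i (LinearMap.snd R E M ∘ₗ P.subtype)
    (fun x y hxy => Subtype.ext (congrArg (fun z : P => z.1.1) hxy))
    (fun m => by
      obtain ⟨e, he⟩ := hp (f m)
      exact ⟨⟨(e, m), he⟩, rfl⟩)
    (by
      ext z
      constructor
      · rintro ⟨x, rfl⟩
        rfl
      · intro hz
        have hz2 : z.1.2 = 0 := hz
        refine ⟨⟨z.1.1, ?_⟩, ?_⟩
        · rw [LinearMap.mem_ker, hP, hz2, map_zero]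
        · exact Subtype.ext (Prod.ext rfl hz2.symm))
  refine ⟨LinearMap.fst R E M ∘ₗ P.subtype ∘ₗ s, LinearMap.ext fun m => ?_⟩
  change p (s m).1.1 = f m
  rw [hP]
  exact congrArg f (LinearMap.congr_fun hs m)

theorem memA_of_exists_section
    (h : ∀ (E : Type u) [AddCommGroup E] [Module R E] (p : E →ₗ[R] M), Function.Surjective p →
      G.IsDivisible (LinearMap.ker p) → ∃ s : M →ₗ[R] E, p ∘ₗ s = LinearMap.id) :
    G.MemA M := by
  intro D _ _ hD E _ _ i p hi hp hip
  refine h E p hp ?_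
  rw [← hip]
  exact hD.of_surjective i.rangeRestrict i.surjective_rangeRestrict

theorem MemA.finsupp_s4 {ι : Type*} {K : Type u} [AddCommGroup K] [Module R K]
    (e : K ≃ₗ[R] (ι →₀ M)) (hM : G.MemA M) : G.MemA K := by
  refine memA_of_exists_section fun E _ _ p hp hker => ?_
  choose s hs using fun i =>
    hM.exists_lift p hp hker (e.symm.toLinearMap ∘ₗ Finsupp.lsingle i)
  refine ⟨Finsupp.lsum ℕ s ∘ₗ e.toLinearMap, ?_⟩
  have : p ∘ₗ Finsupp.lsum ℕ s = e.symm.toLinearMap := by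
    ext i x
    simpa using LinearMap.congr_fun (hs i) x
  rw [← LinearMap.comp_assoc, this]
  ext x
  simp

theorem MemA.of_retract (hM : G.MemA M) (s : N →ₗ[R] M) (r : M →ₗ[R] N)
    (hrs : r ∘ₗ s = LinearMap.id) : G.MemA N := by
  refine memA_of_exists_section fun E _ _ p hp hker => ?_
  obtain ⟨g, hg⟩ := hM.exists_lift p hp hker r
  exact ⟨g ∘ₗ s, by rw [← LinearMap.comp_assoc, hg, hrs]⟩

/-- Maps to a `G`-divisible module extend along monomorphisms with cokernel in `𝒜`. -/
theorem MemA.exists_extension (hM : G.MemA M) (hD : G.IsDivisible D) {A B : Type u}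
    [AddCommGroup A] [Module R A] [AddCommGroup B] [Module R B] (i : A →ₗ[R] B)
    (q : B →ₗ[R] M) (hi : Function.Injective i) (hq : Function.Surjective q)
    (hiq : LinearMap.range i = LinearMap.ker q) (f : A →ₗ[R] D) :
    ∃ g : B →ₗ[R] D, g ∘ₗ i = f := by
  have hqi : ∀ x, q (i x) = 0 := fun x => by
    have : i x ∈ LinearMap.ker q := hiq ▸ LinearMap.mem_range_self i x
    exact this
  let W : Submodule R (D × B) := LinearMap.range ((-f).prod i)
  let j : D →ₗ[R] (D × B) ⧸ W := W.mkQ ∘ₗ LinearMap.inl R D B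
  let p : ((D × B) ⧸ W) →ₗ[R] M := W.liftQ (q ∘ₗ LinearMap.snd R D B) (by
    rintro _ ⟨x, rfl⟩
    exact hqi x)
  have hj : Function.Injective j := by
    rw [← LinearMap.ker_eq_bot, LinearMap.ker_eq_bot']
    intro d hd
    obtain ⟨x, hx⟩ := (Submodule.Quotient.mk_eq_zero W).1 hd
    have h1 : -f x = d := congrArg Prod.fst hx
    have h2 : i x = 0 := congrArg Prod.snd hx
    rw [← h1, (map_eq_zero_iff i hi).1 h2, map_zero, neg_zero]
  have hjp : LinearMap.range j = LinearMap.ker p := by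
    ext z
    obtain ⟨⟨d, b⟩, rfl⟩ := W.mkQ_surjective z
    constructor
    · rintro ⟨d', hd'⟩
      rw [← hd']
      change q 0 = 0
      exact map_zero q
    · intro hz
      have hb : b ∈ LinearMap.range i := hiq ▸ (show q b = 0 from hz)
      obtain ⟨x, rfl⟩ := hb
      refine ⟨d + f x, (Submodule.Quotient.eq W).2 ⟨-x, Prod.ext ?_ ?_⟩⟩ <;> simp
  obtain ⟨s, hs⟩ := hM D hD _ j p hj
    (fun m => by
      obtain ⟨b, rfl⟩ := hq m
      exact ⟨W.mkQ (0, b), rfl⟩) hjp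
  let h : B →ₗ[R] LinearMap.range j :=
    (W.mkQ ∘ₗ LinearMap.inr R D B - s ∘ₗ q).codRestrict _ fun b => by
      rw [hjp, LinearMap.mem_ker, LinearMap.sub_apply, map_sub]
      have : p (s (q b)) = q b := LinearMap.congr_fun hs (q b)
      exact sub_eq_zero.2 this.symm
  refine ⟨(LinearEquiv.ofInjective j hj).symm.toLinearMap ∘ₗ h, LinearMap.ext fun x => ?_⟩
  have hx : h (i x) = LinearEquiv.ofInjective j hj (f x) := by
    refine Subtype.ext ?_
    change W.mkQ (0, i x) - s (q (i x)) = W.mkQ (f x, 0)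
    rw [hqi, map_zero, sub_zero]
    exact (Submodule.Quotient.eq W).2 ⟨x, by simp⟩
  change (LinearEquiv.ofInjective j hj).symm (h (i x)) = f x
  rw [hx, LinearEquiv.symm_apply_apply]

end GabrielTopology

/-- The endomorphism `e_n ↦ e_n - a_n e_{n+1}` of `M^(ℕ)`, whose cokernel is the direct limit of
`M → M → M → ⋯` along the multiplications by the `a_n`. -/
noncomputable def telescope {R : Type*} [CommRing R] (a : ℕ → R) (M : Type*) [AddCommGroup M]
    [Module R M] : (ℕ →₀ M) →ₗ[R] (ℕ →₀ M) :=
  Finsupp.lsum ℕ fun n => Finsupp.lsingle n - a n • Finsupp.lsingle (n + 1)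

/-- The endomorphism of `M^(ℕ)` that pushes the coordinates up to `m` forward to the `m`-th one
along the multiplications by the `a_n`. -/
noncomputable def pushTo {R : Type*} [CommRing R] (a : ℕ → R) (M : Type*) [AddCommGroup M]
    [Module R M] (m : ℕ) : (ℕ →₀ M) →ₗ[R] (ℕ →₀ M) :=
  Finsupp.lsum ℕ fun n =>
    if n ≤ m then (∏ k ∈ Finset.Ico n m, a k) • Finsupp.lsingle m else Finsupp.lsingle n

section telescope

variable {R : Type*} [CommRing R] (a : ℕ → R) {M : Type*} [AddCommGroup M] [Module R M]

theorem telescope_single (n : ℕ) (x : M) :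
    telescope a M (Finsupp.single n x) =
      Finsupp.single n x - a n • Finsupp.single (n + 1) x := by
  simp [telescope]

theorem telescope_apply_zero (y : ℕ →₀ M) : telescope a M y 0 = y 0 := by
  induction y using Finsupp.induction_linear with
  | zero => simp
  | add f g hf hg => simp [hf, hg]
  | single n x => simp [telescope_single]

theorem telescope_apply_succ (y : ℕ →₀ M) (k : ℕ) :
    telescope a M y (k + 1) = y (k + 1) - a k • y k := by
  induction y using Finsupp.induction_linear with
  | zero => simp
  | add f g hf hg => simp only [map_add, Finsupp.add_apply, hf, hg, smul_add]; abel
  | single n x =>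
    rw [telescope_single]
    by_cases h : n = k
    · subst h; simp
    · simp [Finsupp.single_apply, h]

theorem telescope_injective : Function.Injective (telescope a M) := by
  rw [← LinearMap.ker_eq_bot, LinearMap.ker_eq_bot']
  intro y hy
  ext k
  induction k with
  | zero => rw [← telescope_apply_zero a, hy]
  | succ k ih =>
    have := telescope_apply_succ a y k
    rw [hy, ih] at this
    simpa using this.symm

theorem mkQ_single_eq (n : ℕ) (x : M) :
    (LinearMap.range (telescope a M)).mkQ (Finsupp.single n x) =
      a n • (LinearMap.range (telescope a M)).mkQ (Finsupp.single (n + 1) x) := by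
  rw [← map_smul]
  exact (Submodule.Quotient.eq _).2 ⟨Finsupp.single n x, telescope_single a n x⟩

theorem mkQ_comp_pushTo (m : ℕ) :
    (LinearMap.range (telescope a M)).mkQ ∘ₗ pushTo a M m =
      (LinearMap.range (telescope a M)).mkQ := by
  refine Finsupp.lhom_ext fun n x => ?_
  simp only [pushTo, LinearMap.comp_apply, Finsupp.lsum_single]
  split_ifs with h
  · simp only [LinearMap.smul_apply, Finsupp.lsingle_apply, map_smul]
    induction m, h using Nat.le_induction with
    | base => simp
    | succ m h ih => rw [Finset.prod_Ico_succ_top h, mul_smul, ← mkQ_single_eq, ih]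
  · rfl

theorem exists_pushTo_telescope_eq_zero (y : ℕ →₀ M) :
    ∃ m₀, ∀ m, m₀ ≤ m → pushTo a M m (telescope a M y) = 0 := by
  induction y using Finsupp.induction_linear with
  | zero => exact ⟨0, fun m _ => by simp⟩
  | add f g hf hg =>
    obtain ⟨k, hk⟩ := hf
    obtain ⟨l, hl⟩ := hg
    exact ⟨max k l, fun m hm => by
      rw [map_add, map_add, hk m (le_of_max_le_left hm), hl m (le_of_max_le_right hm), add_zero]⟩
  | single n x =>
    refine ⟨n + 1, fun m hm => ?_⟩
    rw [telescope_single, map_sub, map_smul]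
    simp only [pushTo, Finsupp.lsum_single, if_pos hm, if_pos (Nat.le_of_succ_le hm),
      LinearMap.smul_apply]
    rw [Finset.prod_eq_prod_Ico_succ_bot hm, mul_smul, sub_self]

end telescope

namespace GabrielTopology

variable {R : Type u} [CommRing R] {G : GabrielTopology R}

/-- If `𝒜` is covering, then it contains the direct limit of `X → X → X → ⋯` for every
`X ∈ 𝒜 ∩ 𝒟_G` and all multiplication maps. -/
theorem IsACovering.memA_telescope_s4 (hcov : G.IsACovering) (a : ℕ → R) {X : Type u}
    [AddCommGroup X] [Module R X] (hA : G.MemA X) (hD : G.IsDivisible X) :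
    G.MemA ((ℕ →₀ X) ⧸ LinearMap.range (telescope a X)) := by
  let q := (LinearMap.range (telescope a X)).mkQ
  have hker : G.IsDivisible (LinearMap.ker q) := by
    rw [Submodule.ker_mkQ]
    exact hD.finsupp_s4.of_surjective (telescope a X).rangeRestrict
      (telescope a X).surjective_rangeRestrict
  obtain ⟨C, φ, hC, hpre, hcover⟩ := hcov ((ℕ →₀ X) ⧸ LinearMap.range (telescope a X))
  obtain ⟨g, hg⟩ := hpre (ℕ →₀ X) (hA.finsupp_s4 (LinearEquiv.refl R _)) q
  obtain ⟨h, hh⟩ := hC.exists_lift q (Submodule.mkQ_surjective _) hker φ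
  have hinj : Function.Injective φ := by
    rw [← LinearMap.ker_eq_bot, LinearMap.ker_eq_bot']
    intro c hc
    have hqc : q (h c) = 0 := by rw [← LinearMap.comp_apply, hh, hc]
    obtain ⟨y, hy⟩ := (Submodule.Quotient.mk_eq_zero _).1 hqc
    obtain ⟨m, hm⟩ := exists_pushTo_telescope_eq_zero a y
    have hbij := hcover (g ∘ₗ pushTo a X m ∘ₗ h) (by
      rw [← LinearMap.comp_assoc, hg, ← LinearMap.comp_assoc, mkQ_comp_pushTo, hh])
    refine (map_eq_zero_iff _ hbij.1).1 ?_
    rw [LinearMap.comp_apply, LinearMap.comp_apply, ← hy, hm m le_rfl, map_zero]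
  have hsurj : Function.Surjective φ := by
    intro z
    obtain ⟨y, rfl⟩ := Submodule.mkQ_surjective _ z
    exact ⟨g y, LinearMap.congr_fun hg y⟩
  let e := LinearEquiv.ofBijective φ ⟨hinj, hsurj⟩
  exact hC.of_retract e.symm.toLinearMap e.toLinearMap (by ext; simp)

/-- For a finitely generated `J ∈ G`, the telescope of `R → R → R → ⋯` splits modulo `J`. -/
theorem IsACovering.exists_telescope_splitting_mod_fg (hcov : G.IsACovering)
    (hG : G.IsTiltingTopology) (a : ℕ → R) {J : Ideal R} (hJ : J ∈ G.sets) (hfg : J.FG) :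
    ∃ p : ℕ → ℕ →₀ R, ∀ n k,
      (p n - a n • p (n + 1) - Finsupp.single n 1 : ℕ →₀ R) k ∈ J := by
  obtain ⟨-, -, T, ⟨-, hT2, T0, T1, i, π, ⟨ι0, s0, r0, h0⟩, ⟨ι1, s1, r1, h1⟩, hi, hπ, hiπ⟩,
    hT⟩ := hG
  have hTA : G.MemA T := fun D _ _ hD => (hT D).2 hD
  have hT0A : G.MemA T0 :=
    (hTA.finsupp_s4 (LinearEquiv.refl R (ι0 →₀ T))).of_retract s0 r0 h0
  have hT1A : G.MemA T1 :=
    (hTA.finsupp_s4 (LinearEquiv.refl R (ι1 →₀ T))).of_retract s1 r1 h1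
  have hT0D : G.IsDivisible T0 := ((hT _).1 (hT2 ι0)).of_surjective r0
    fun y => ⟨s0 y, LinearMap.congr_fun h0 y⟩
  have hT1D : G.IsDivisible T1 := hT0D.of_surjective π hπ
  have hπi : ∀ r, π (i r) = 0 := fun r => by
    have : i r ∈ LinearMap.ker π := hiπ ▸ LinearMap.mem_range_self i r
    exact this
  have exists_map_eq : ∀ (D : Type u) [AddCommGroup D] [Module R D], G.IsDivisible D → ∀ d : D,
      ∃ μ : T0 →ₗ[R] D, μ (i 1) = d := fun D _ _ hD d => by
    obtain ⟨μ, hμ⟩ := hT1A.exists_extension hD i π hi hπ hiπ (LinearMap.toSpanSingleton R D d)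
    exact ⟨μ, by simpa using LinearMap.congr_fun hμ 1⟩
  obtain ⟨m, x, hx⟩ := Submodule.fg_iff_exists_fin_generating_family.1 hfg
  have hxJ : ∀ k, x k ∈ J := fun k => hx ▸ Submodule.subset_span ⟨k, rfl⟩
  have hdiv : ∀ (D : Type u) [AddCommGroup D] [Module R D], G.IsDivisible D → ∀ d : D,
      ∃ c : Fin m → D, ∑ k, x k • c k = d := fun D _ _ hD d => by
    have hd : d ∈ J • (⊤ : Submodule R D) := by rw [hD J hJ]; trivial
    rw [← hx] at hd
    induction hd using Submodule.smul_induction_on' with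
    | smul r hr y _ =>
      obtain ⟨c, rfl⟩ := (Submodule.mem_span_range_iff_exists_fun R).1 hr
      exact ⟨fun k => c k • y, by simp [Finset.sum_smul, smul_smul, mul_comm]⟩
    | add y _ z _ hy hz =>
      obtain ⟨c, rfl⟩ := hy
      obtain ⟨c', rfl⟩ := hz
      exact ⟨c + c', by simp [smul_add, Finset.sum_add_distrib]⟩
  have sum_smul_single : ∀ {D : Type u} [AddCommGroup D] [Module R D] (n : ℕ) (y : Fin m → D),
      ∑ k, x k • Finsupp.single n (y k) = Finsupp.single n (∑ k, x k • y k) := fun n y => by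
    simp_rw [← Finsupp.lsingle_apply (R := R), map_sum, map_smul]
  let w : Fin m →₀ T0 := Finsupp.equivFunOnFinite.symm fun k => x k • i 1
  let W : Submodule R (Fin m →₀ T0) := Submodule.span R {w}
  have hw : ∀ {D : Type u} [AddCommGroup D] [Module R D] (μ : Fin m → T0 →ₗ[R] D),
      Finsupp.lsum ℕ μ w = ∑ k, x k • μ k (i 1) := fun μ => by
    simp [w, Finsupp.sum_fintype]
  have hXD : G.IsDivisible ((Fin m →₀ T0) ⧸ W) :=
    hT0D.finsupp_s4.of_surjective W.mkQ W.mkQ_surjective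
  have hXA : G.MemA ((Fin m →₀ T0) ⧸ W) := by
    refine memA_of_exists_section fun E _ _ p hp hker => ?_
    obtain ⟨g, hg⟩ := (hT0A.finsupp_s4 (LinearEquiv.refl R (Fin m →₀ T0))).exists_lift p hp hker
      W.mkQ
    have hgw : g w ∈ LinearMap.ker p := by
      rw [LinearMap.mem_ker, ← LinearMap.comp_apply, hg]
      exact (Submodule.Quotient.mk_eq_zero W).2 (Submodule.mem_span_singleton_self w)
    obtain ⟨c, hc⟩ := hdiv _ hker ⟨g w, hgw⟩
    choose μ hμ using fun k => exists_map_eq _ hker (c k)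
    let g' := g - (LinearMap.ker p).subtype ∘ₗ Finsupp.lsum ℕ μ
    refine ⟨W.liftQ g' ?_, ?_⟩
    · rw [Submodule.span_singleton_le_iff_mem, LinearMap.mem_ker]
      simp only [g', LinearMap.sub_apply, LinearMap.comp_apply, hw, hμ, hc]
      simp
    · refine Submodule.linearMap_qext _ (LinearMap.ext fun z => ?_)
      have hz : p (g z) = W.mkQ z := LinearMap.congr_fun hg z
      have hz' : p (Finsupp.lsum ℕ μ z : LinearMap.ker p).1 = 0 :=
        (Finsupp.lsum ℕ μ z : LinearMap.ker p).2
      change p (g z - (Finsupp.lsum ℕ μ z : LinearMap.ker p).1) = W.mkQ z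
      rw [map_sub, hz, hz', sub_zero]
  have hD : G.IsDivisible (ℕ →₀ T1) := hT1D.finsupp_s4
  obtain ⟨t, ht⟩ := hdiv T0 hT0D (i 1)
  choose μ hμ using fun (n : ℕ) (k : Fin m) =>
    exists_map_eq (ℕ →₀ T1) hD (Finsupp.single n (π (t k)))
  let l : ℕ → ((Fin m →₀ T0) ⧸ W) →ₗ[R] (ℕ →₀ T1) := fun n =>
    W.liftQ (Finsupp.lsum ℕ (μ n)) (by
      rw [Submodule.span_singleton_le_iff_mem, LinearMap.mem_ker, hw]
      simp only [hμ, sum_smul_single]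
      simp_rw [← map_smul, ← map_sum, ht, hπi, Finsupp.single_zero])
  obtain ⟨L, hL⟩ := (hcov.memA_telescope_s4 a hXA hXD).exists_extension hD (telescope a _)
    (LinearMap.range (telescope a _)).mkQ (telescope_injective a) (Submodule.mkQ_surjective _)
    (Submodule.ker_mkQ _).symm (Finsupp.lsum ℕ l)
  let b : Fin m → (Fin m →₀ T0) ⧸ W := fun k => W.mkQ (Finsupp.single k (i 1))
  have hb : ∑ k, x k • b k = 0 := by
    simp only [b, ← map_smul, ← map_sum]
    refine (Submodule.Quotient.mk_eq_zero W).2 ?_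
    convert Submodule.mem_span_singleton_self w using 1
    ext k
    simp [w, Finsupp.single_apply, Finsupp.finsetSum_apply]
  let v : ℕ → Fin m → ℕ →₀ T1 := fun n k => L (Finsupp.single n (b k))
  have hv : ∀ n k, v n k - a n • v (n + 1) k = Finsupp.single n (π (t k)) := fun n k => by
    have := LinearMap.congr_fun hL (Finsupp.single n (b k))
    rw [LinearMap.comp_apply, telescope_single, map_sub, map_smul] at this
    rw [this]
    simp [l, b, hμ]
  have hv0 : ∀ n, ∑ k, x k • v n k = 0 := fun n => by
    simp_rw [v, ← map_smul, ← map_sum, sum_smul_single, hb, Finsupp.single_zero, map_zero]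
  let I : (ℕ →₀ R) →ₗ[R] (ℕ →₀ T0) := Finsupp.mapRange.linearMap i
  let ρ : (ℕ →₀ T0) →ₗ[R] (ℕ →₀ T1) := Finsupp.mapRange.linearMap π
  have hI : Function.Injective I := Finsupp.mapRange_injective i (map_zero i) hi
  have hρ : Function.Surjective ρ := Finsupp.mapRange_surjective π (map_zero π) hπ
  have hex : ∀ y, ρ y = 0 → ∃ z, I z = y := fun y hy => by
    have : y ∈ LinearMap.range I := by
      rw [Finsupp.range_mapRange_linearMap, hiπ, ← Finsupp.ker_mapRange]
      · exact hy
      · exact LinearMap.ker_eq_bot.2 hi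
    exact this
  choose v' hv' using fun n k => hρ (v n k)
  choose p hp using fun n => hex (∑ k, x k • v' n k) (by simp [map_sum, hv', hv0])
  choose r hr using fun n k => hex (v' n k - a n • v' (n + 1) k - Finsupp.single n (t k)) (by
    rw [map_sub, map_sub, map_smul, hv', hv', hv]
    simp [ρ])
  refine ⟨p, fun n k => ?_⟩
  have key : p n - a n • p (n + 1) - Finsupp.single n 1 = ∑ k, x k • r n k := by
    apply hI
    have h1 : I (Finsupp.single n 1) = ∑ k, x k • Finsupp.single n (t k) := by
      rw [sum_smul_single, ht]
      simp [I]
    simp only [map_sub, map_smul, map_sum, hp, hr, h1, smul_sub, Finset.sum_sub_distrib,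
      Finset.smul_sum]
    simp only [smul_comm (a n)]
  rw [key, Finsupp.finsetSum_apply]
  exact Ideal.sum_mem _ fun j _ => J.mul_mem_right _ (hxJ j)

end GabrielTopology

theorem projective_tensor_of_telescope_splitting {R : Type*} [CommRing R] (a : ℕ → R)
    {F : Type*} [AddCommGroup F] [Module R F]
    (e : F ≃ₗ[R] Module.DirectLimit (fun _ : ℕ => R)
      (fun i j _ => LinearMap.toSpanSingleton R R (∏ k ∈ Finset.Ico i j, a k)))
    (S : Type*) [CommRing S] [Algebra R S] (p : ℕ → ℕ →₀ S)
    (hp : ∀ n, p n - a n • p (n + 1) = Finsupp.single n 1) :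
    Module.Projective S (TensorProduct R S F) := by
  let f : ℕ → F := fun n => e.symm (Module.DirectLimit.of R ℕ (fun _ : ℕ => R)
      (fun i j _ => LinearMap.toSpanSingleton R R (∏ k ∈ Finset.Ico i j, a k)) n 1)
  have hf : ∀ n, f n = a n • f (n + 1) := fun n => by
    simp only [f, ← map_smul]
    rw [← Module.DirectLimit.of_f (hij := Nat.le_succ n)]
    simp
  let c : ℕ → ℕ →₀ S := fun n => Finsupp.single n 1 - telescope a S (p n)
  have hc : ∀ n, c n = a n • c (n + 1) := fun n => by
    rw [← sub_eq_zero]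
    calc c n - a n • c (n + 1)
        = (Finsupp.single n 1 - a n • Finsupp.single (n + 1) 1) -
            telescope a S (p n - a n • p (n + 1)) := by
          simp only [c, map_sub, map_smul, smul_sub]; abel
      _ = 0 := by rw [hp, telescope_single, sub_self]
  have hcj : ∀ i j, i ≤ j → c i = (∏ k ∈ Finset.Ico i j, a k) • c j := fun i j hij => by
    induction j, hij using Nat.le_induction with
    | base => simp
    | succ j h ih => rw [Finset.prod_Ico_succ_top h, mul_smul, ← hc, ih]
  let s₀ : F →ₗ[R] (ℕ →₀ S) := Module.DirectLimit.lift R ℕ (fun _ : ℕ => R)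
      (fun i j _ => LinearMap.toSpanSingleton R R (∏ k ∈ Finset.Ico i j, a k))
      (fun n => LinearMap.toSpanSingleton R _ (c n))
      (fun i j hij y => by simp [mul_smul, ← hcj i j hij]) ∘ₗ e.toLinearMap
  have hs₀ : ∀ n, s₀ (f n) = c n := fun n => by simp [s₀, f]
  let s : TensorProduct R S F →ₗ[S] (ℕ →₀ S) := LinearMap.liftBaseChange S s₀
  let r : (ℕ →₀ S) →ₗ[S] TensorProduct R S F :=
    Finsupp.linearCombination S fun n => TensorProduct.tmul R 1 (f n)
  have hrt : ∀ y, r (telescope a S y) = 0 := fun y => by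
    induction y using Finsupp.induction_linear with
    | zero => simp
    | add y z hy hz => simp [hy, hz]
    | single n z =>
      rw [telescope_single, map_sub, sub_eq_zero]
      simp only [r, Finsupp.smul_single, Finsupp.linearCombination_single, hf n]
      simp [TensorProduct.smul_tmul']
  refine Module.Projective.of_split s r ?_
  refine TensorProduct.AlgebraTensorModule.curry_injective ?_
  ext y
  obtain ⟨z, rfl⟩ := e.symm.surjective y
  obtain ⟨n, z, rfl⟩ := Module.DirectLimit.exists_of z
  have hz : e.symm (Module.DirectLimit.of R ℕ (fun _ : ℕ => R)
      (fun i j _ => LinearMap.toSpanSingleton R R (∏ k ∈ Finset.Ico i j, a k)) n z) =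
      z • f n := by
    simp only [f, ← map_smul, smul_eq_mul, mul_one]
  have hrc : r (c n) = TensorProduct.tmul R 1 (f n) := by
    simp only [c, map_sub, hrt, sub_zero]
    simp [r]
  have key : r (s (TensorProduct.tmul R 1 (f n))) = TensorProduct.tmul R 1 (f n) := by
    simp [s, hs₀, hrc]
  rw [hz]
  simp only [TensorProduct.AlgebraTensorModule.curry_apply,
    TensorProduct.curry_apply, LinearMap.coe_restrictScalars, LinearMap.comp_apply,
    TensorProduct.tmul_smul, LinearMap.map_smul_of_tower, key, LinearMap.id_apply]

theorem stmt4 (R : Type u) [CommRing R] (G : GabrielTopology R)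
    (hG : G.IsTiltingTopology) (hcov : G.IsACovering)
    (a : ℕ → R) (F : Type u) [AddCommGroup F] [Module R F]
    (hF : Nonempty (F ≃ₗ[R] Module.DirectLimit (fun _ : ℕ => R)
      (fun i j _ => LinearMap.toSpanSingleton R R (∏ k ∈ Finset.Ico i j, a k))))
    (J : Ideal R) (hJ : J ∈ G.sets) :
    ∃ (P : ModuleCat.{u} (R ⧸ J)) (π : ↥P →ₗ[R ⧸ J] TensorProduct R (R ⧸ J) F),
      Module.Projective (R ⧸ J) ↥P ∧ Function.Surjective π ∧
      ∀ N : Submodule (R ⧸ J) ↥P, N ⊔ LinearMap.ker π = ⊤ → N = ⊤ := by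
  obtain ⟨e⟩ := hF
  obtain ⟨J', hJ', hle, hfg⟩ := hG.2.1 J hJ
  obtain ⟨p, hp⟩ := hcov.exists_telescope_splitting_mod_fg hG a hJ' hfg
  let ψ : (ℕ →₀ R) →ₗ[R] (ℕ →₀ R ⧸ J) :=
    Finsupp.mapRange.linearMap (Algebra.linearMap R (R ⧸ J))
  have hψ : ∀ n, ψ (p n) - a n • ψ (p (n + 1)) = Finsupp.single n 1 := fun n => by
    have h1 : ψ (p n - a n • p (n + 1) - Finsupp.single n 1) = 0 := by
      ext k
      exact Ideal.Quotient.eq_zero_iff_mem.2 (hle (hp n k))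
    have h2 : ψ (Finsupp.single n 1) = Finsupp.single n 1 := by simp [ψ]
    rwa [map_sub, map_sub, map_smul, h2, sub_eq_zero] at h1
  have := projective_tensor_of_telescope_splitting a e (R ⧸ J) (fun n => ψ (p n)) hψ
  refine ⟨ModuleCat.of _ (TensorProduct R (R ⧸ J) F), LinearMap.id, this,
    Function.surjective_id, fun N hN => ?_⟩
  rwa [LinearMap.ker_id, sup_bot_eq] at hN
end
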